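/- Let r, s > 0 with s ∈ (r, r+1) ∪ (r+1, ∞), let X be exponentially distributed with rate parameter λ > 0 (so P has density f(x) = λ e^{−λx} 1_{{x>0}} on ℝ), and let (α_n)_{n≥1} be an L^r(P)-optimal sequence of quantizers. Then: (i) the sequence (θ·α_n)_{n≥1} = (α_n^{θ,0})_{n≥1} is L^s(P)-rate-optimal if and only if θ ∈ (s/(r+1), ∞); (ii) the function θ ↦ θ^{s+1} ∫_0^∞ f(θx) f(x)^{−s/(r+1)} dx attains a unique minimum on (s/(r+1), ∞) at θ* = (s+1)/(r+1). -/

import Mathlib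

open MeasureTheory ENNReal Filter Set Metric Topology
open scoped Classical

noncomputable section

/-- Distance from a point `x ∈ ℝ` to a finite codebook `α`. -/
def qdist1 (x : ℝ) (α : Finset ℝ) : ℝ := Metric.infDist x (α : Set ℝ)

/-- The `r`-th power `L^r` quantization error `∫ d(x,α)^r dP` of a codebook `α`. -/
def qerr1 (P : Measure ℝ) (r : ℝ) (α : Finset ℝ) : ℝ≥0∞ :=
  ∫⁻ x, ENNReal.ofReal (qdist1 x α) ^ r ∂P

/-- The optimal `n`-level `L^r` quantization error `e_{n,r}(P)`. -/
def enr1 (P : Measure ℝ) (r : ℝ) (n : ℕ) : ℝ≥0∞ :=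
  ⨅ (α : Finset ℝ) (_ : α.Nonempty) (_ : α.card ≤ n), qerr1 P r α ^ (1 / r)

/-- The constant `J_{r,1} = inf_{n ≥ 1} n^r e_{n,r}(U([0,1]))^r`. -/
def J1 (r : ℝ) : ℝ≥0∞ :=
  ⨅ (n : ℕ) (_ : 1 ≤ n), (n : ℝ≥0∞) ^ r * enr1 (volume.restrict (Icc (0 : ℝ) 1)) r n ^ r

/-- Zador's constant `Q_r(P)` on `ℝ` for `P = f·λ_1`. -/
def Q1 (f : ℝ → ℝ) (r : ℝ) : ℝ≥0∞ :=
  J1 r * (∫⁻ x, ENNReal.ofReal (f x) ^ (1 / (1 + r))) ^ (1 + r : ℝ)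

/-- The scaled codebook `θ·α = {θa : a ∈ α}`. -/
def scaleCB (θ : ℝ) (α : Finset ℝ) : Finset ℝ := α.image fun a => θ * a

/-- An `L^r(P)`-optimal sequence of `n`-quantizers on `ℝ`. -/
def OptimalSeq1 (P : Measure ℝ) (r : ℝ) (α : ℕ → Finset ℝ) : Prop :=
  ∀ n, 1 ≤ n → (α n).Nonempty ∧ (α n).card ≤ n ∧ qerr1 P r (α n) = enr1 P r n ^ r

/-- An asymptotically `L^r(P)`-optimal sequence of quantizers on `ℝ`, `P = f·λ_1`. -/
def AsympOptimalSeq1 (P : Measure ℝ) (f : ℝ → ℝ) (r : ℝ) (α : ℕ → Finset ℝ) : Prop :=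
  (∀ n, 1 ≤ n → (α n).Nonempty ∧ (α n).card ≤ n) ∧
  Tendsto (fun n : ℕ => (n : ℝ≥0∞) ^ r * qerr1 P r (α n)) atTop (𝓝 (Q1 f r))

/-- `L^s(P)`-rate-optimality of a sequence of codebooks on `ℝ`. -/
def RateOptimal1 (P : Measure ℝ) (s : ℝ) (β : ℕ → Finset ℝ) : Prop :=
  limsup (fun n : ℕ => (n : ℝ≥0∞) ^ s * qerr1 P s (β n)) atTop < ⊤

/-- The density of the exponential distribution with rate `l`. -/
def expDensity (l x : ℝ) : ℝ := if 0 < x then l * Real.exp (-(l * x)) else 0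

/-- `θ ↦ θ^{s+1} ∫_0^∞ f(θx) f(x)^{-s/(r+1)} dx` for the exponential density `f`. -/
def expF (l r s θ : ℝ) : ℝ≥0∞ :=
  ENNReal.ofReal θ ^ (s + 1 : ℝ) *
    ∫⁻ x in Ioi (0 : ℝ), ENNReal.ofReal (expDensity l (θ * x)) *
      ENNReal.ofReal (expDensity l x) ^ (-(s / (r + 1)))


/-- The exponential law with rate `l`. -/
def expLaw (l : ℝ) : Measure ℝ :=
  volume.withDensity fun x => ENNReal.ofReal (expDensity l x)

lemma qdist1_nonneg (x : ℝ) (β : Finset ℝ) : 0 ≤ qdist1 x β := infDist_nonneg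

lemma continuous_qdist1 (β : Finset ℝ) : Continuous fun x => qdist1 x β :=
  continuous_infDist_pt _

lemma qdist1_le {β : Finset ℝ} {a : ℝ} (ha : a ∈ β) (x : ℝ) : qdist1 x β ≤ |x - a| :=
  infDist_le_dist_of_mem ha

lemma exists_qdist1_eq {β : Finset ℝ} (hβ : β.Nonempty) (x : ℝ) :
    ∃ a ∈ β, qdist1 x β = |x - a| :=
  β.finite_toSet.isCompact.exists_infDist_eq_dist hβ x

lemma qdist1_le_add (x y : ℝ) (β : Finset ℝ) : qdist1 x β ≤ qdist1 y β + |x - y| :=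
  infDist_le_infDist_add_dist

lemma le_qdist1 {β : Finset ℝ} (hβ : β.Nonempty) {x d : ℝ} (h : ∀ a ∈ β, d ≤ |x - a|) :
    d ≤ qdist1 x β := by
  obtain ⟨a, ha, h'⟩ := exists_qdist1_eq hβ x
  exact h' ▸ h a ha

lemma qdist1_insert_le {β : Finset ℝ} (hβ : β.Nonempty) (x b : ℝ) :
    qdist1 x (insert b β) ≤ qdist1 x β :=
  infDist_le_infDist_of_subset (by simp) (by simpa using hβ)

lemma scaleCB_nonempty {θ : ℝ} {β : Finset ℝ} (hβ : β.Nonempty) : (scaleCB θ β).Nonempty :=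
  hβ.image _

lemma qdist1_scaleCB {θ : ℝ} (hθ : 0 < θ) {β : Finset ℝ} (hβ : β.Nonempty) (x : ℝ) :
    qdist1 (θ * x) (scaleCB θ β) ≤ θ * qdist1 x β := by
  obtain ⟨a, ha, h⟩ := exists_qdist1_eq hβ x
  rw [h, ← abs_of_pos hθ, ← abs_mul, mul_sub, abs_of_pos hθ]
  exact qdist1_le (Finset.mem_image_of_mem _ ha) _

lemma measurable_expDensity (l : ℝ) : Measurable (expDensity l) := by
  unfold expDensity
  exact Measurable.ite measurableSet_Ioi (by fun_prop) measurable_const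

lemma measurable_qdist1_rpow (β : Finset ℝ) (r : ℝ) : Measurable fun x => qdist1 x β ^ r :=
  (continuous_qdist1 β).measurable.pow_const r

lemma qerr1_expLaw {l r : ℝ} (hl : 0 < l) (hr : 0 ≤ r) (β : Finset ℝ) :
    qerr1 (expLaw l) r β =
      ∫⁻ x in Ioi 0, ENNReal.ofReal (l * Real.exp (-(l * x)) * qdist1 x β ^ r) := by
  unfold qerr1 expLaw
  rw [lintegral_withDensity_eq_lintegral_mul _ (measurable_expDensity l).ennreal_ofReal
    (((continuous_qdist1 β).measurable.ennreal_ofReal).pow_const r),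
    ← lintegral_indicator measurableSet_Ioi]
  refine lintegral_congr fun x => ?_
  by_cases hx : 0 < x
  · rw [indicator_of_mem (mem_Ioi.2 hx), Pi.mul_apply, expDensity, if_pos hx,
      ENNReal.ofReal_rpow_of_nonneg (qdist1_nonneg x β) hr, ← ENNReal.ofReal_mul (by positivity)]
  · rw [indicator_of_notMem (by simpa using hx), Pi.mul_apply, expDensity, if_neg hx]
    simp

lemma lintegral_exp_Ioc {p x z : ℝ} (hp : 0 < p) (hxz : x ≤ z) :
    ∫⁻ u in Ioc x z, ENNReal.ofReal (Real.exp (-(p * u))) =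
      ENNReal.ofReal ((Real.exp (-(p * x)) - Real.exp (-(p * z))) / p) := by
  have hc : Continuous fun u => Real.exp (-(p * u)) := by fun_prop
  rw [← ofReal_integral_eq_lintegral_ofReal
    ((hc.intervalIntegrable x z).1) (ae_of_all _ fun u => (Real.exp_pos _).le),
    ← intervalIntegral.integral_of_le hxz]
  congr 1
  rw [intervalIntegral.integral_eq_sub_of_hasDerivAt
    (f := fun u => -(Real.exp (-(p * u)) / p)) (fun u _ => ?_) (hc.intervalIntegrable x z)]
  · ring
  · have := ((((hasDerivAt_id u).const_mul p).neg.exp).div_const p).neg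
    refine this.congr_deriv ?_
    simp only [id]
    field_simp
    rfl

lemma lintegral_exp_Ioi {a : ℝ} (ha : 0 < a) :
    ∫⁻ u in Ioi (0 : ℝ), ENNReal.ofReal (Real.exp (-(a * u))) = ENNReal.ofReal (1 / a) := by
  have h := integrableOn_exp_mul_Ioi (neg_neg_of_pos ha) 0
  have h' := integral_exp_mul_Ioi (neg_neg_of_pos ha) 0
  simp only [neg_mul] at h h'
  rw [← ofReal_integral_eq_lintegral_ofReal h (ae_of_all _ fun u => (Real.exp_pos _).le), h']
  simp

/-- Pointwise comparison of a power with the exponential, tuned to `p = l / (r + 1)`. -/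
lemma rpow_mul_exp_le {p r x u z : ℝ} (hp : 0 < p) (hr : 0 ≤ r) (hxu : x ≤ u) (huz : u ≤ z) :
    Real.exp (-((r + 1) * p * u)) * (u - x) ^ r ≤
      p ^ (-r) * (Real.exp (-(p * x)) - Real.exp (-(p * z))) ^ r * Real.exp (-(p * u)) := by
  have h1 : u - x ≤ p⁻¹ * (Real.exp (-(p * x)) - Real.exp (-(p * z))) * Real.exp (p * u) := by
    have h2 := Real.add_one_le_exp (p * (u - x))
    have h3 : Real.exp (-(p * z)) ≤ Real.exp (-(p * u)) :=
      Real.exp_le_exp.2 (neg_le_neg (mul_le_mul_of_nonneg_left huz hp.le))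
    have h4 : Real.exp (p * (u - x)) - 1 =
        (Real.exp (-(p * x)) - Real.exp (-(p * u))) * Real.exp (p * u) := by
      rw [sub_mul, ← Real.exp_add, ← Real.exp_add]
      congr 1
      · congr 1; ring
      · simp
    have h5 : p * (u - x) ≤
        (Real.exp (-(p * x)) - Real.exp (-(p * z))) * Real.exp (p * u) := by
      calc p * (u - x) ≤ _ := by linarith
        _ = _ := h4
        _ ≤ _ := by gcongr
    rw [mul_assoc, inv_mul_eq_div, le_div_iff₀ hp]
    linarith
  have h0 : 0 ≤ Real.exp (-(p * x)) - Real.exp (-(p * z)) :=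
    sub_nonneg.2 (Real.exp_le_exp.2 (neg_le_neg (mul_le_mul_of_nonneg_left (hxu.trans huz) hp.le)))
  have h6 := Real.rpow_le_rpow (sub_nonneg.2 hxu) h1 hr
  rw [Real.mul_rpow (by positivity) (by positivity), Real.mul_rpow (by positivity) h0,
    Real.inv_rpow hp.le, ← Real.rpow_neg hp.le, ← Real.exp_mul] at h6
  calc _ ≤ Real.exp (-((r + 1) * p * u)) *
        (p ^ (-r) * (Real.exp (-(p * x)) - Real.exp (-(p * z))) ^ r * Real.exp (p * u * r)) := by
        gcongr
    _ = p ^ (-r) * (Real.exp (-(p * x)) - Real.exp (-(p * z))) ^ r *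
        (Real.exp (-((r + 1) * p * u)) * Real.exp (p * u * r)) := by ring
    _ = _ := by
        rw [← Real.exp_add]
        congr 2
        ring

/-- Cost of removing a codepoint lying between two others. -/
lemma qerr1_erase_le {l r : ℝ} (hl : 0 < l) (hr : 0 < r) {γ : Finset ℝ} {x y z : ℝ}
    (hxy : x < y) (hyz : y < z) (hx : x ∈ γ) (hz : z ∈ γ) :
    qerr1 (expLaw l) r (γ.erase y) ≤ qerr1 (expLaw l) r γ +
      ENNReal.ofReal (l * (l / (r + 1)) ^ (-(r + 1)) *
        (Real.exp (-(l / (r + 1) * x)) - Real.exp (-(l / (r + 1) * z))) ^ (r + 1)) := by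
  set p := l / (r + 1) with hp
  have hp0 : 0 < p := by positivity
  have hlp : (r + 1) * p = l := by rw [hp]; field_simp
  set G := Real.exp (-(p * x)) - Real.exp (-(p * z)) with hG
  have hG0 : 0 < G :=
    sub_pos.2 (Real.exp_lt_exp.2 (neg_lt_neg (mul_lt_mul_of_pos_left (hxy.trans hyz) hp0)))
  have hx' : x ∈ γ.erase y := Finset.mem_erase.2 ⟨hxy.ne, hx⟩
  have hz' : z ∈ γ.erase y := Finset.mem_erase.2 ⟨hyz.ne', hz⟩
  have hmeas : Measurable fun u => ENNReal.ofReal (l * Real.exp (-(l * u)) * qdist1 u γ ^ r) :=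
    (Measurable.mul (by fun_prop) (measurable_qdist1_rpow γ r)).ennreal_ofReal
  rw [qerr1_expLaw hl hr.le, qerr1_expLaw hl hr.le]
  calc _ ≤ ∫⁻ u in Ioi 0, (ENNReal.ofReal (l * Real.exp (-(l * u)) * qdist1 u γ ^ r) +
        (Ioc x z).indicator
          (fun u => ENNReal.ofReal (l * p ^ (-r) * G ^ r) * ENNReal.ofReal (Real.exp (-(p * u)))) u) := by
        refine lintegral_mono fun u => ?_
        by_cases hu : u ∈ Ioc x z
        · refine le_add_left ?_
          rw [indicator_of_mem hu, ← ENNReal.ofReal_mul (by positivity)]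
          refine ENNReal.ofReal_le_ofReal ?_
          have h1 : qdist1 u (γ.erase y) ≤ u - x := by
            simpa [abs_of_pos (sub_pos.2 hu.1)] using qdist1_le hx' u
          have h2 := rpow_mul_exp_le hp0 hr.le hu.1.le hu.2
          rw [hlp] at h2
          have h3 := Real.rpow_le_rpow (qdist1_nonneg u _) h1 hr.le
          calc _ ≤ l * (Real.exp (-(l * u)) * (u - x) ^ r) := by
                rw [mul_assoc]; gcongr
            _ ≤ l * _ := mul_le_mul_of_nonneg_left h2 hl.le
            _ = _ := by ring
        · refine le_add_right (ENNReal.ofReal_le_ofReal ?_)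
          have h1 : qdist1 u (γ.erase y) ≤ qdist1 u γ := by
            refine le_qdist1 ⟨x, hx⟩ fun a ha => ?_
            by_cases hay : a = y
            · subst hay
              by_cases hux : u ≤ x
              · refine (qdist1_le hx' u).trans ?_
                rw [abs_of_nonpos (by linarith), abs_of_nonpos (by linarith)]
                linarith
              · have : z < u := by
                  by_contra hzu
                  exact hu ⟨not_le.1 hux, not_lt.1 hzu⟩
                refine (qdist1_le hz' u).trans ?_
                rw [abs_of_nonneg (by linarith), abs_of_nonneg (by linarith)]
                linarith
            · exact qdist1_le (Finset.mem_erase.2 ⟨hay, ha⟩) u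
          have := qdist1_nonneg u (γ.erase y)
          gcongr
    _ ≤ _ := by
        rw [lintegral_add_left hmeas]
        gcongr
        refine (setLIntegral_le_lintegral _ _).trans ?_
        rw [lintegral_indicator measurableSet_Ioc, lintegral_const_mul _ (by fun_prop),
          lintegral_exp_Ioc hp0 (hxy.trans hyz).le, ← ENNReal.ofReal_mul (by positivity)]
        refine ENNReal.ofReal_le_ofReal (le_of_eq ?_)
        rw [← hG, neg_add, Real.rpow_add hp0, Real.rpow_add hG0, Real.rpow_one, Real.rpow_neg_one]
        ring

lemma qerr1_singleton_zero_lt_top {l r : ℝ} (hl : 0 < l) (hr : 0 < r) :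
    qerr1 (expLaw l) r {0} < ⊤ := by
  set p := l / (r + 1) with hp
  have hp0 : 0 < p := by positivity
  have hlp : (r + 1) * p = l := by rw [hp]; field_simp
  rw [qerr1_expLaw hl hr.le]
  calc _ ≤ ∫⁻ u in Ioi 0, ENNReal.ofReal (l * p ^ (-r)) * ENNReal.ofReal (Real.exp (-(p * u))) := by
        refine setLIntegral_mono (by fun_prop) fun u hu => ?_
        rw [← ENNReal.ofReal_mul (by positivity)]
        refine ENNReal.ofReal_le_ofReal ?_
        have hu : 0 < u := hu
        have h1 : qdist1 u {0} = u := by simp [qdist1, abs_of_pos hu]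
        have h2 := rpow_mul_exp_le (x := 0) (z := u) hp0 hr.le hu.le le_rfl
        rw [hlp, sub_zero] at h2
        have h3 : (Real.exp (-(p * 0)) - Real.exp (-(p * u))) ^ r ≤ 1 := by
          refine Real.rpow_le_one (sub_nonneg.2 (Real.exp_le_exp.2 ?_)) ?_ hr.le
          · simp; positivity
          · simpa using (Real.exp_pos _).le
        rw [h1, mul_assoc]
        calc l * (Real.exp (-(l * u)) * u ^ r) ≤ l * _ := mul_le_mul_of_nonneg_left h2 hl.le
          _ ≤ l * (p ^ (-r) * 1 * Real.exp (-(p * u))) := by gcongr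
          _ = _ := by ring
    _ < ⊤ := by
        rw [lintegral_const_mul _ (by fun_prop), lintegral_exp_Ioi hp0]
        exact ENNReal.mul_lt_top ENNReal.ofReal_lt_top ENNReal.ofReal_lt_top

/-- Gain obtained by adding a codepoint at `b`. -/
lemma qerr1_insert_add_le {l r : ℝ} (hl : 0 < l) (hr : 0 < r) {β : Finset ℝ} (hβ : β.Nonempty)
    {b w : ℝ} (hb : 0 ≤ b) (hw : 0 < w) (hw1 : w ≤ 1) (hwb : w ≤ qdist1 b β) :
    qerr1 (expLaw l) r (insert b β) + ENNReal.ofReal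
      (l * Real.exp (-l) * (((2 / 3) ^ r - (1 / 3) ^ r) / 3) * (w ^ (r + 1) * Real.exp (-(l * b)))) ≤
      qerr1 (expLaw l) r β := by
  set κ : ℝ := (2 / 3) ^ r - (1 / 3) ^ r with hκ
  have hκ0 : 0 < κ := sub_pos.2 (Real.rpow_lt_rpow (by norm_num) (by norm_num) hr)
  set c : ℝ := l * Real.exp (-(l * (b + 1))) * (κ * w ^ r) with hc
  have hc0 : 0 ≤ c := by positivity
  have hmeas : Measurable fun u =>
      ENNReal.ofReal (l * Real.exp (-(l * u)) * qdist1 u (insert b β) ^ r) :=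
    (Measurable.mul (by fun_prop) (measurable_qdist1_rpow _ r)).ennreal_ofReal
  have hsub : Ioc b (b + w / 3) ⊆ Ioi 0 := fun u hu => lt_of_le_of_lt hb hu.1
  have hconst : ENNReal.ofReal
      (l * Real.exp (-l) * (κ / 3) * (w ^ (r + 1) * Real.exp (-(l * b)))) =
      ∫⁻ u in Ioi (0 : ℝ), (Ioc b (b + w / 3)).indicator (fun _ => ENNReal.ofReal c) u := by
    rw [setLIntegral_indicator measurableSet_Ioc, inter_eq_left.2 hsub, setLIntegral_const,
      Real.volume_Ioc, ← ENNReal.ofReal_mul hc0, Real.rpow_add hw, Real.rpow_one, hc,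
      show -(l * (b + 1)) = -l + -(l * b) by ring, Real.exp_add]
    congr 1
    ring
  rw [qerr1_expLaw hl hr.le, qerr1_expLaw hl hr.le, hconst, ← lintegral_add_left hmeas]
  refine lintegral_mono fun u => ?_
  have hi0 := qdist1_nonneg u (insert b β)
  by_cases hu : u ∈ Ioc b (b + w / 3)
  · rw [indicator_of_mem hu, ← ENNReal.ofReal_add (by positivity) hc0]
    refine ENNReal.ofReal_le_ofReal ?_
    have hub : |u - b| ≤ w / 3 := by
      rw [abs_of_pos (sub_pos.2 hu.1)]; linarith [hu.2]
    have h1 : qdist1 u (insert b β) ≤ 1 / 3 * w :=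
      ((qdist1_le (Finset.mem_insert_self b β) u).trans hub).trans (by linarith)
    have h2 : 2 / 3 * w ≤ qdist1 u β := by
      have := qdist1_le_add b u β
      rw [abs_sub_comm] at this
      linarith
    have h3 := Real.rpow_le_rpow hi0 h1 hr.le
    have h4 := Real.rpow_le_rpow (by positivity) h2 hr.le
    rw [Real.mul_rpow (by norm_num) hw.le] at h3 h4
    have h5 : Real.exp (-(l * (b + 1))) ≤ Real.exp (-(l * u)) := by
      refine Real.exp_le_exp.2 (neg_le_neg (mul_le_mul_of_nonneg_left ?_ hl.le))
      linarith [hu.2]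
    calc l * Real.exp (-(l * u)) * qdist1 u (insert b β) ^ r + c
        ≤ l * Real.exp (-(l * u)) * ((1 / 3) ^ r * w ^ r) +
          l * Real.exp (-(l * u)) * (κ * w ^ r) := by
          rw [hc]; gcongr
      _ = l * Real.exp (-(l * u)) * ((2 / 3) ^ r * w ^ r) := by rw [hκ]; ring
      _ ≤ _ := by gcongr
  · rw [indicator_of_notMem hu, add_zero]
    refine ENNReal.ofReal_le_ofReal ?_
    have := qdist1_insert_le hβ u b
    gcongr

lemma volume_le_qdist1 (β : Finset ℝ) (hβ : β.Nonempty) (u : ℝ) {h : ℝ} (hh : 0 < h) {m : ℕ}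
    (hm : (β.filter (· ∈ Icc u (u + h))).card ≤ m) :
    ENNReal.ofReal (h / 2) ≤
      volume (Ioc u (u + h) ∩ {x | h / (4 * ((m : ℝ) + 2)) ≤ qdist1 x β}) := by
  set η := h / (4 * ((m : ℝ) + 2)) with hη
  have hη0 : 0 < η := by positivity
  set S := insert u (insert (u + h) (β.filter (· ∈ Icc u (u + h)))) with hS
  have hScard : S.card ≤ m + 2 :=
    (Finset.card_insert_le _ _).trans (by
      have := Finset.card_insert_le (u + h) (β.filter (· ∈ Icc u (u + h)))
      omega)
  have hcover : Ioc u (u + h) ⊆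
      (Ioc u (u + h) ∩ {x | η ≤ qdist1 x β}) ∪ ⋃ a ∈ S, ball a η := by
    intro x hx
    by_cases hxη : η ≤ qdist1 x β
    · exact Or.inl ⟨hx, hxη⟩
    · right
      obtain ⟨a, ha, hxa⟩ := exists_qdist1_eq hβ x
      rw [hxa, not_le, abs_lt] at hxη
      simp only [mem_iUnion, mem_ball, Real.dist_eq, abs_lt, exists_prop]
      by_cases hau : a < u
      · exact ⟨u, by simp [hS], by linarith [hx.1], by linarith⟩
      by_cases hau' : u + h < a
      · exact ⟨u + h, by simp [hS], by linarith, by linarith [hx.2]⟩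
      · exact ⟨a, by simp [hS, ha, not_lt.1 hau, not_lt.1 hau'], hxη⟩
  have hball : volume (⋃ a ∈ S, ball a η) ≤ ENNReal.ofReal (h / 2) := by
    refine (measure_biUnion_finset_le S _).trans ?_
    simp only [Real.volume_ball, Finset.sum_const, nsmul_eq_mul]
    rw [← ENNReal.ofReal_natCast, ← ENNReal.ofReal_mul (by positivity)]
    refine ENNReal.ofReal_le_ofReal ?_
    have : (S.card : ℝ) ≤ m + 2 := by exact_mod_cast hScard
    calc (S.card : ℝ) * (2 * η) ≤ (m + 2) * (2 * η) := by gcongr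
      _ = h / 2 := by rw [hη]; field_simp; ring
  have h1 := (measure_mono (μ := volume) hcover).trans (measure_union_le _ _)
  rw [Real.volume_Ioc, show u + h - u = h / 2 + h / 2 by ring,
    ENNReal.ofReal_add (by positivity) (by positivity)] at h1
  have h2 := h1.trans (add_le_add_right hball _)
  exact (ENNReal.add_le_add_iff_right ENNReal.ofReal_ne_top).1 h2

lemma exists_three_close (S : Finset ℝ) (φ : ℝ → ℝ) {G : ℝ} (hG : 0 < G) {N : ℕ} (hN : 0 < N)
    (hφ : ∀ x ∈ S, 0 ≤ φ x ∧ φ x ≤ G) (hcard : 2 * (N + 1) < S.card) :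
    ∃ x ∈ S, ∃ y ∈ S, ∃ z ∈ S, x < y ∧ y < z ∧ φ x - φ z ≤ G / N := by
  have hN' : (0 : ℝ) < N := by exact_mod_cast hN
  obtain ⟨j, -, hj⟩ := Finset.exists_lt_card_fiber_of_mul_lt_card_of_maps_to
    (s := S) (t := Finset.range (N + 1)) (f := fun x => ⌊φ x * N / G⌋₊) (n := 2)
    (fun x hx => by
      rw [Finset.mem_range, Nat.lt_succ_iff]
      refine Nat.floor_le_of_le ?_
      rw [div_le_iff₀ hG, mul_comm]
      exact mul_le_mul_of_nonneg_left (hφ x hx).2 hN'.le)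
    (by rw [Finset.card_range]; omega)
  set F := S.filter fun x => ⌊φ x * N / G⌋₊ = j with hF
  have hFS : ∀ x ∈ F, x ∈ S := fun x hx => (Finset.mem_filter.1 hx).1
  have hclose : ∀ x ∈ F, ∀ z ∈ F, φ x - φ z ≤ G / N := by
    intro x hx z hz
    have h1 := Nat.lt_floor_add_one (φ x * N / G)
    have h2 := Nat.floor_le (a := φ z * N / G)
      (div_nonneg (mul_nonneg (hφ z (hFS z hz)).1 hN'.le) hG.le)
    rw [(Finset.mem_filter.1 hx).2] at h1
    rw [(Finset.mem_filter.1 hz).2] at h2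
    have h3 : φ x * N / G ≤ φ z * N / G + 1 := by linarith
    rw [le_div_iff₀ hN']
    rw [div_add_one hG.ne', div_le_div_iff_of_pos_right hG] at h3
    linarith
  obtain ⟨a, ha, b, hb, c, hc, hab, hac, hbc⟩ := Finset.two_lt_card.1 hj
  have key : ∃ x ∈ F, ∃ y ∈ F, ∃ z ∈ F, x < y ∧ y < z := by
    rcases lt_or_gt_of_ne hab with h1 | h1 <;> rcases lt_or_gt_of_ne hac with h2 | h2 <;>
      rcases lt_or_gt_of_ne hbc with h3 | h3
    · exact ⟨a, ha, b, hb, c, hc, h1, h3⟩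
    · exact ⟨a, ha, c, hc, b, hb, h2, h3⟩
    · linarith
    · exact ⟨c, hc, a, ha, b, hb, h2, h1⟩
    · exact ⟨b, hb, a, ha, c, hc, h1, h2⟩
    · linarith
    · exact ⟨b, hb, c, hc, a, ha, h3, h2⟩
    · exact ⟨c, hc, b, hb, a, ha, h3, h1⟩
  obtain ⟨x, hx, y, hy, z, hz, hxy, hyz⟩ := key
  exact ⟨x, hFS x hx, y, hFS y hy, z, hFS z hz, hxy, hyz, hclose x hx z hz⟩

/-- Points on the negative axis may be moved to the origin. -/
lemma qerr1_image_max_zero_le {l r : ℝ} (hl : 0 < l) (hr : 0 < r) {β : Finset ℝ}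
    (hβ : β.Nonempty) :
    qerr1 (expLaw l) r (β.image fun a => max a 0) ≤ qerr1 (expLaw l) r β := by
  rw [qerr1_expLaw hl hr.le, qerr1_expLaw hl hr.le]
  refine setLIntegral_mono
    (Measurable.mul (by fun_prop) (measurable_qdist1_rpow _ r)).ennreal_ofReal fun u hu => ?_
  have hu : 0 < u := hu
  refine ENNReal.ofReal_le_ofReal ?_
  have : qdist1 u (β.image fun a => max a 0) ≤ qdist1 u β := by
    refine le_qdist1 hβ fun a ha => ?_
    refine (qdist1_le (Finset.mem_image_of_mem _ ha) u).trans ?_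
    rcases le_total a 0 with h | h
    · rw [max_eq_right h, abs_of_nonneg (by linarith), abs_of_nonneg (by linarith)]
      linarith
    · rw [max_eq_left h]
  have := qdist1_nonneg u (β.image fun a => max a 0)
  gcongr

lemma OptimalSeq1.qerr1_le {P : Measure ℝ} {r : ℝ} (hr : 0 < r) {α : ℕ → Finset ℝ}
    (hα : OptimalSeq1 P r α) {n : ℕ} (hn : 1 ≤ n) {β : Finset ℝ} (hβ : β.Nonempty)
    (hcard : β.card ≤ n) : qerr1 P r (α n) ≤ qerr1 P r β := by
  rw [(hα n hn).2.2]
  have h : enr1 P r n ≤ qerr1 P r β ^ (1 / r) :=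
    iInf_le_of_le β (iInf_le_of_le hβ (iInf_le _ hcard))
  calc enr1 P r n ^ r ≤ (qerr1 P r β ^ (1 / r)) ^ r := ENNReal.rpow_le_rpow h hr.le
    _ = _ := by rw [← ENNReal.rpow_mul, one_div_mul_cancel hr.ne', ENNReal.rpow_one]

lemma OptimalSeq1.qerr1_lt_top {l r : ℝ} (hl : 0 < l) (hr : 0 < r) {α : ℕ → Finset ℝ}
    (hα : OptimalSeq1 (expLaw l) r α) {n : ℕ} (hn : 1 ≤ n) :
    qerr1 (expLaw l) r (α n) < ⊤ :=
  (hα.qerr1_le hr hn (Finset.singleton_nonempty 0) (by simpa using hn)).trans_lt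
    (qerr1_singleton_zero_lt_top hl hr)

lemma exists_qerr1_insert_add_le {l r : ℝ} (hl : 0 < l) (hr : 0 < r) :
    ∃ c > 0, ∀ n : ℕ, ∀ β : Finset ℝ, β.Nonempty → β.card < n →
      ∃ b, qerr1 (expLaw l) r (insert b β) + ENNReal.ofReal (c * (1 / n) ^ (r + 1)) ≤
        qerr1 (expLaw l) r β := by
  have hκ : (0 : ℝ) < (2 / 3) ^ r - (1 / 3) ^ r :=
    sub_pos.2 (Real.rpow_lt_rpow (by norm_num) (by norm_num) hr)
  refine ⟨l * Real.exp (-l) * (((2 / 3) ^ r - (1 / 3) ^ r) / 3) *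
    ((1 / 12) ^ (r + 1) * Real.exp (-l)), by positivity, fun n β hβ hcard => ?_⟩
  have hn : 1 ≤ n := by omega
  have hn' : (1 : ℝ) ≤ n := by exact_mod_cast hn
  have hvol := volume_le_qdist1 β hβ 0 one_pos (m := n)
    ((Finset.card_filter_le _ _).trans hcard.le)
  obtain ⟨b, hb, hbd⟩ : (Ioc (0 : ℝ) (0 + 1) ∩
      {x | 1 / (4 * ((n : ℝ) + 2)) ≤ qdist1 x β}).Nonempty := by
    refine nonempty_of_measure_ne_zero (μ := volume) fun h0 => ?_
    rw [h0, nonpos_iff_eq_zero, ENNReal.ofReal_eq_zero] at hvol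
    norm_num at hvol
  have hbd : 1 / (4 * ((n : ℝ) + 2)) ≤ qdist1 b β := hbd
  refine ⟨b, le_trans ?_ (qerr1_insert_add_le hl hr hβ hb.1.le
    (w := 1 / (12 * n)) (by positivity) ?_ ?_)⟩
  · rw [show (1 : ℝ) / (12 * n) = 1 / 12 * (1 / n) by field_simp,
      Real.mul_rpow (by positivity) (by positivity)]
    have hexp : Real.exp (-l) ≤ Real.exp (-(l * b)) := by
      refine Real.exp_le_exp.2 (neg_le_neg (mul_le_of_le_one_right hl.le ?_))
      linarith [hb.2]
    refine add_le_add_right (ENNReal.ofReal_le_ofReal ?_) _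
    rw [mul_assoc _ (_ * _) (_ ^ (r + 1)), mul_right_comm ((1 / 12) ^ (r + 1))]
    gcongr
  · rw [div_le_one (by positivity)]; linarith
  · refine le_trans ?_ hbd
    exact one_div_le_one_div_of_le (by positivity) (by linarith)

/-- Triples of points of an optimal codebook are spread out. -/
lemma OptimalSeq1.exists_gap {l r : ℝ} (hl : 0 < l) (hr : 0 < r) {α : ℕ → Finset ℝ}
    (hα : OptimalSeq1 (expLaw l) r α) :
    ∃ c > 0, ∀ n : ℕ, 1 ≤ n → ∀ x ∈ α n, ∀ y ∈ α n, ∀ z ∈ α n, x < y → y < z →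
      c / n ≤ Real.exp (-(l / (r + 1) * x)) - Real.exp (-(l / (r + 1) * z)) := by
  obtain ⟨c, hc, h⟩ := exists_qerr1_insert_add_le hl hr
  set K := l * (l / (r + 1)) ^ (-(r + 1)) with hK
  have hK0 : 0 < K := by positivity
  refine ⟨(c / K) ^ (r + 1)⁻¹, by positivity, fun n hn x hx y hy z hz hxy hyz => ?_⟩
  have hn' : (0 : ℝ) < n := by exact_mod_cast hn
  have hG : 0 ≤ Real.exp (-(l / (r + 1) * x)) - Real.exp (-(l / (r + 1) * z)) := by
    refine sub_nonneg.2 (Real.exp_le_exp.2 (neg_le_neg (mul_le_mul_of_nonneg_left ?_ ?_)))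
    · linarith
    · positivity
  have hcard : ((α n).erase y).card < n := by
    have h1 := Finset.card_erase_lt_of_mem hy
    have h2 := (hα n hn).2.1
    omega
  obtain ⟨b, hb⟩ := h n ((α n).erase y) ⟨x, Finset.mem_erase.2 ⟨hxy.ne, hx⟩⟩ hcard
  have h1 := hα.qerr1_le hr hn (Finset.insert_nonempty b ((α n).erase y))
    ((Finset.card_insert_le _ _).trans hcard)
  have h2 := (add_le_add_left h1 _).trans (hb.trans (qerr1_erase_le hl hr hxy hyz hx hz))
  rw [ENNReal.add_le_add_iff_left (hα.qerr1_lt_top hl hr hn).ne,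
    ENNReal.ofReal_le_ofReal_iff (by positivity)] at h2
  rw [← Real.rpow_le_rpow_iff (by positivity) hG (z := r + 1) (by positivity),
    Real.div_rpow (by positivity) hn'.le, Real.rpow_inv_rpow (by positivity) (by positivity)]
  rw [Real.div_rpow one_pos.le hn'.le, Real.one_rpow] at h2
  rw [div_div, div_le_iff₀ (by positivity)]
  rw [mul_one_div, div_le_iff₀ (by positivity)] at h2
  linarith

/-- One additional codepoint improves the optimal error by at most `O(n ^ (-(r + 1)))`. -/
lemma OptimalSeq1.qerr1_le_succ {l r : ℝ} (hl : 0 < l) (hr : 0 < r) {α : ℕ → Finset ℝ}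
    (hα : OptimalSeq1 (expLaw l) r α) {n : ℕ} (hn : 4 ≤ n) :
    qerr1 (expLaw l) r (α n) ≤ qerr1 (expLaw l) r (α (n + 1)) +
      ENNReal.ofReal (l * (l / (r + 1)) ^ (-(r + 1)) * (8 / n) ^ (r + 1)) := by
  have hne := (hα (n + 1) (by omega)).1
  set γ := (α (n + 1)).image fun a => max a 0 with hγ
  have hγne : γ.Nonempty := hne.image _
  have hγle := qerr1_image_max_zero_le hl hr hne
  have hn' : (4 : ℝ) ≤ n := by exact_mod_cast hn
  rcases le_or_gt γ.card n with hc | hc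
  · exact le_add_right ((hα.qerr1_le hr (by omega) hγne hc).trans hγle)
  · have hp : 0 < l / (r + 1) := by positivity
    have hγ0 : ∀ x ∈ γ, 0 ≤ x := by
      intro x hx
      obtain ⟨a, -, rfl⟩ := Finset.mem_image.1 hx
      exact le_max_right _ _
    have hcard : γ.card ≤ n + 1 := Finset.card_image_le.trans (hα (n + 1) (by omega)).2.1
    obtain ⟨x, hx, y, hy, z, hz, hxy, hyz, hxz⟩ := exists_three_close γ
      (fun x => Real.exp (-(l / (r + 1) * x))) one_pos (N := n / 4) (by omega)
      (fun x hx => ⟨(Real.exp_pos _).le, Real.exp_le_one_iff.2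
        (neg_nonpos.2 (mul_nonneg hp.le (hγ0 x hx)))⟩) (by omega)
    have h1 := hα.qerr1_le hr (n := n) (by omega) (β := γ.erase y)
      ⟨x, Finset.mem_erase.2 ⟨hxy.ne, hx⟩⟩ (by
        have := Finset.card_erase_lt_of_mem hy
        omega)
    refine h1.trans ((qerr1_erase_le hl hr hxy hyz hx hz).trans ?_)
    have hG : 0 ≤ Real.exp (-(l / (r + 1) * x)) - Real.exp (-(l / (r + 1) * z)) :=
      sub_nonneg.2 (Real.exp_le_exp.2 (neg_le_neg
        (mul_le_mul_of_nonneg_left (hxy.trans hyz).le hp.le)))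
    have h8 : (1 : ℝ) / (n / 4 : ℕ) ≤ 8 / n := by
      have h9 : n ≤ 8 * (n / 4) := by omega
      have h9' : (n : ℝ) ≤ 8 * (n / 4 : ℕ) := by exact_mod_cast h9
      have h10 : (0 : ℝ) < (n / 4 : ℕ) := by
        have : 0 < n / 4 := by omega
        exact_mod_cast this
      rw [div_le_div_iff₀ h10 (by linarith)]
      linarith
    gcongr
    exact hxz.trans h8

lemma OptimalSeq1.exists_min_qdist1_le {l r : ℝ} (hl : 0 < l) (hr : 0 < r) {α : ℕ → Finset ℝ}
    (hα : OptimalSeq1 (expLaw l) r α) :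
    ∃ C > 0, ∀ n : ℕ, 4 ≤ n → ∀ b, 0 ≤ b →
      min (qdist1 b (α n)) 1 ≤ C / n * Real.exp (l / (r + 1) * b) := by
  have hκ : (0 : ℝ) < (2 / 3) ^ r - (1 / 3) ^ r :=
    sub_pos.2 (Real.rpow_lt_rpow (by norm_num) (by norm_num) hr)
  set c := l * Real.exp (-l) * (((2 / 3) ^ r - (1 / 3) ^ r) / 3) with hc
  have hc0 : 0 < c := by positivity
  set K := l * (l / (r + 1)) ^ (-(r + 1)) with hK
  have hK0 : 0 < K := by positivity
  refine ⟨(K / c) ^ (r + 1)⁻¹ * 8, by positivity, fun n hn b hb => ?_⟩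
  have hn' : (0 : ℝ) < n := by
    have : 0 < n := by omega
    exact_mod_cast this
  rcases (qdist1_nonneg b (α n)).eq_or_lt with h0 | h0
  · rw [← h0, min_eq_left zero_le_one]; positivity
  set w := min (qdist1 b (α n)) 1 with hw
  have hw0 : 0 < w := lt_min h0 one_pos
  have hne := (hα n (by omega)).1
  have h1 := qerr1_insert_add_le hl hr hne hb hw0 (min_le_right _ _) (min_le_left _ _)
  have h2 := hα.qerr1_le hr (n := n + 1) (by omega) (Finset.insert_nonempty b (α n))
    ((Finset.card_insert_le _ _).trans (by
      have := (hα n (by omega)).2.1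
      omega))
  have h3 := (add_le_add_left h2 _).trans (h1.trans (hα.qerr1_le_succ hl hr hn))
  rw [ENNReal.add_le_add_iff_left (hα.qerr1_lt_top hl hr (by omega)).ne,
    ENNReal.ofReal_le_ofReal_iff (by positivity)] at h3
  rw [← Real.rpow_le_rpow_iff hw0.le (by positivity) (z := r + 1) (by positivity),
    Real.mul_rpow (by positivity) (by positivity), mul_div_assoc,
    Real.mul_rpow (by positivity) (by positivity),
    Real.rpow_inv_rpow (by positivity) (by positivity), ← Real.exp_mul,
    show l / (r + 1) * b * (r + 1) = l * b by field_simp]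
  rw [← hc, ← hK, Real.exp_neg, ← div_eq_mul_inv, ← mul_div_assoc,
    div_le_iff₀ (Real.exp_pos _)] at h3
  rw [show K / c * (8 / n) ^ (r + 1) * Real.exp (l * b) =
    K * (8 / n) ^ (r + 1) * Real.exp (l * b) / c by ring, le_div_iff₀ hc0]
  linarith

/-- Upper bound on the local distances of optimal codebooks. -/
lemma OptimalSeq1.exists_qdist1_le {l r : ℝ} (hl : 0 < l) (hr : 0 < r) {α : ℕ → Finset ℝ}
    (hα : OptimalSeq1 (expLaw l) r α) :
    ∃ C > 0, ∀ᶠ n : ℕ in atTop, ∀ b, 0 ≤ b →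
      qdist1 b (α n) ≤ C / n * Real.exp (l / (r + 1) * b) := by
  obtain ⟨C, hC, h⟩ := hα.exists_min_qdist1_le hl hr
  set p := l / (r + 1) with hp
  have hp0 : 0 < p := by positivity
  refine ⟨C * (1 + Real.exp p / p), by positivity, ?_⟩
  filter_upwards [eventually_ge_atTop 4, eventually_gt_atTop ⌈C⌉₊] with n hn hnC b hb
  have hn' : (0 : ℝ) < n := by
    have : 0 < n := by omega
    exact_mod_cast this
  have hCn : C / n < 1 := by
    rw [div_lt_one hn']
    exact (Nat.le_ceil C).trans_lt (by exact_mod_cast hnC)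
  rcases le_or_gt (qdist1 b (α n)) 1 with hd | hd
  · have h1 := h n hn b hb
    rw [min_eq_left hd] at h1
    refine h1.trans ?_
    gcongr
    exact le_mul_of_one_le_right hC.le (by have : 0 < Real.exp p / p := by positivity
                                           linarith)
  · set d := qdist1 b (α n) with hdd
    have h0 : qdist1 0 (α n) < 1 := by
      have h1 := h n hn 0 le_rfl
      rw [mul_zero, Real.exp_zero, mul_one] at h1
      rcases min_lt_iff.1 (h1.trans_lt hCn) with h2 | h2
      · exact h2
      · exact absurd h2 (lt_irrefl _)
    have h1 := qdist1_le_add b 0 (α n)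
    rw [sub_zero, abs_of_nonneg hb] at h1
    have h2 := qdist1_le_add b (b - (d - 1)) (α n)
    rw [_root_.sub_sub_cancel, abs_of_pos (by linarith)] at h2
    have h3 := h n hn (b - (d - 1)) (by linarith)
    rw [min_eq_right (by linarith)] at h3
    have h4 : d ≤ Real.exp (p * d) / p := by
      rw [le_div_iff₀ hp0]
      linarith [Real.add_one_le_exp (p * d)]
    calc d ≤ Real.exp (p * d) / p := h4
      _ ≤ Real.exp (p * d) / p * (C / n * Real.exp (p * (b - (d - 1)))) :=
        le_mul_of_one_le_right (by positivity) h3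
      _ = C * (Real.exp p / p) / n * Real.exp (p * b) := by
        rw [show p * (b - (d - 1)) = p * b + p - p * d by ring, Real.exp_sub, Real.exp_add]
        field_simp
      _ ≤ _ := by
        gcongr
        linarith

/-- Upper bound on the local number of points of optimal codebooks. -/
lemma OptimalSeq1.exists_card_le {l r : ℝ} (hl : 0 < l) (hr : 0 < r) {α : ℕ → Finset ℝ}
    (hα : OptimalSeq1 (expLaw l) r α) :
    ∃ C > 0, ∀ n : ℕ, 1 ≤ n → ∀ u, 1 ≤ n * Real.exp (-(l / (r + 1) * u)) →
      (((α n).filter (· ∈ Icc u (u + 1))).card : ℝ) + 2 ≤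
        C * (n * Real.exp (-(l / (r + 1) * u))) := by
  obtain ⟨c, hc, h⟩ := hα.exists_gap hl hr
  refine ⟨2 / c + 6, by positivity, fun n hn u hu => ?_⟩
  have hn' : (0 : ℝ) < n := by exact_mod_cast hn
  set p := l / (r + 1) with hp
  have hp0 : 0 < p := by positivity
  set t := n * Real.exp (-(p * u)) with ht
  set N := ⌊t / c⌋₊ + 1 with hN
  have hN1 : t / c < N := by exact_mod_cast Nat.lt_floor_add_one (t / c)
  have hN0 : (0 : ℝ) < N := by positivity
  have hN2 : (N : ℝ) ≤ t / c + 1 := by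
    have := Nat.floor_le (a := t / c) (by positivity)
    rw [hN]; push_cast; linarith
  have hcard : ((α n).filter (· ∈ Icc u (u + 1))).card ≤ 2 * (N + 1) := by
    by_contra! hcard
    obtain ⟨x, hx, y, hy, z, hz, hxy, hyz, hxz⟩ := exists_three_close
      ((α n).filter (· ∈ Icc u (u + 1)))
      (fun x => Real.exp (-(p * x))) (Real.exp_pos (-(p * u))) (N := N) (by omega)
      (fun x hx => ⟨(Real.exp_pos _).le, Real.exp_le_exp.2
        (neg_le_neg (mul_le_mul_of_nonneg_left (Finset.mem_filter.1 hx).2.1 hp0.le))⟩) hcard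
    have h1 := (h n hn x (Finset.mem_filter.1 hx).1 y (Finset.mem_filter.1 hy).1 z
      (Finset.mem_filter.1 hz).1 hxy hyz).trans hxz
    rw [div_le_div_iff₀ hn' hN0] at h1
    rw [div_lt_iff₀ hc, ht] at hN1
    linarith
  have hcard' : (((α n).filter (· ∈ Icc u (u + 1))).card : ℝ) ≤ 2 * (N + 1) := by
    exact_mod_cast hcard
  calc _ ≤ 2 * (t / c + 2) + 2 := by linarith
    _ ≤ 2 * (t / c) + 6 * t := by linarith
    _ = _ := by ring

lemma natCast_rpow_eq_ofReal (n : ℕ) {s : ℝ} (hs : 0 ≤ s) :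
    (n : ℝ≥0∞) ^ s = ENNReal.ofReal ((n : ℝ) ^ s) := by
  rw [← ENNReal.ofReal_natCast, ENNReal.ofReal_rpow_of_nonneg n.cast_nonneg hs]

lemma OptimalSeq1.rateOptimal1_scaleCB {l r s θ : ℝ} (hl : 0 < l) (hr : 0 < r) (hs : 0 < s)
    {α : ℕ → Finset ℝ} (hα : OptimalSeq1 (expLaw l) r α) (hθ : s / (r + 1) < θ) :
    RateOptimal1 (expLaw l) s fun n => scaleCB θ (α n) := by
  have hθ0 : 0 < θ := lt_trans (by positivity) hθ
  obtain ⟨C, hC, h⟩ := hα.exists_qdist1_le hl hr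
  set p := l / (r + 1) with hp
  have hp0 : 0 < p := by positivity
  have ha : 0 < l - p / θ * s := by
    rw [sub_pos, hp, div_div, div_mul_eq_mul_div, div_lt_iff₀ (by positivity)]
    rw [div_lt_iff₀ (by positivity)] at hθ
    calc l * s < l * (θ * (r + 1)) := mul_lt_mul_of_pos_left hθ hl
      _ = _ := by ring
  set B := ENNReal.ofReal (l * (θ * C) ^ s) * ENNReal.ofReal (1 / (l - p / θ * s)) with hB
  have hBtop : B < ⊤ := ENNReal.mul_lt_top ENNReal.ofReal_lt_top ENNReal.ofReal_lt_top
  refine lt_of_le_of_lt (limsup_le_of_le (h := ?_)) hBtop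
  filter_upwards [h, eventually_ge_atTop 1] with n hn hn1
  have hn' : (0 : ℝ) < n := by exact_mod_cast hn1
  rw [qerr1_expLaw hl hs.le, natCast_rpow_eq_ofReal n hs.le, hB, ← lintegral_exp_Ioi ha,
    ← lintegral_const_mul' _ _ ENNReal.ofReal_ne_top,
    ← lintegral_const_mul' _ _ ENNReal.ofReal_ne_top]
  refine setLIntegral_mono (by fun_prop) fun x hx => ?_
  have hx : 0 < x := hx
  have h1 := qdist1_scaleCB hθ0 (hα n hn1).1 (x / θ)
  rw [mul_div_cancel₀ _ hθ0.ne'] at h1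
  have h2 : qdist1 x (scaleCB θ (α n)) ≤ θ * C / n * Real.exp (p / θ * x) := by
    refine h1.trans ((mul_le_mul_of_nonneg_left (hn _ (by positivity)) hθ0.le).trans_eq ?_)
    rw [show p * (x / θ) = p / θ * x by ring]
    ring
  have h3 := Real.rpow_le_rpow (qdist1_nonneg _ _) h2 hs.le
  rw [Real.mul_rpow (by positivity) (by positivity), Real.div_rpow (by positivity) hn'.le,
    ← Real.exp_mul] at h3
  rw [← ENNReal.ofReal_mul (by positivity), ← ENNReal.ofReal_mul (by positivity)]
  refine ENNReal.ofReal_le_ofReal ?_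
  calc _ ≤ (n : ℝ) ^ s * (l * Real.exp (-(l * x)) *
        ((θ * C) ^ s / n ^ s * Real.exp (p / θ * x * s))) := by gcongr
    _ = l * (θ * C) ^ s * (Real.exp (-(l * x)) * Real.exp (p / θ * x * s)) := by
        field_simp
    _ = _ := by
        rw [← Real.exp_add]
        congr 2
        ring

/-- Lower bound for the scaled error on one unit block. -/
lemma OptimalSeq1.exists_le_lintegral_Ioc {l r s θ : ℝ} (hl : 0 < l) (hr : 0 < r) (hs : 0 < s)
    {α : ℕ → Finset ℝ} (hα : OptimalSeq1 (expLaw l) r α) (hθ0 : 0 < θ)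
    (hθ : θ ≤ s / (r + 1)) :
    ∃ c > 0, ∀ n : ℕ, 1 ≤ n → ∀ u, 0 ≤ u → 1 ≤ n * Real.exp (-(l / (r + 1) * u)) →
      ENNReal.ofReal (c / n ^ s) ≤ ∫⁻ x in Ioc (θ * u) (θ * u + θ),
        ENNReal.ofReal (l * Real.exp (-(l * x)) * qdist1 x (scaleCB θ (α n)) ^ s) := by
  obtain ⟨C, hC, h⟩ := hα.exists_card_le hl hr
  set p := l / (r + 1) with hp
  have hp0 : 0 < p := by positivity
  refine ⟨l * Real.exp (-(l * θ)) * (θ / (4 * C)) ^ s * (θ / 2), by positivity,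
    fun n hn u hu0 hu => ?_⟩
  have hn' : (0 : ℝ) < n := by exact_mod_cast hn
  set m := ((α n).filter (· ∈ Icc u (u + 1))).card with hm
  have hcard : ((scaleCB θ (α n)).filter (· ∈ Icc (θ * u) (θ * u + θ))).card ≤ m := by
    refine (Finset.card_le_card (t := ((α n).filter (· ∈ Icc u (u + 1))).image (θ * ·))
      fun x hx => ?_).trans Finset.card_image_le
    obtain ⟨hx1, hx2, hx3⟩ := Finset.mem_filter.1 hx
    obtain ⟨a, ha, rfl⟩ := Finset.mem_image.1 hx1
    refine Finset.mem_image_of_mem _ (Finset.mem_filter.2 ⟨ha, ?_, ?_⟩)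
    · exact le_of_mul_le_mul_left hx2 hθ0
    · refine le_of_mul_le_mul_left (hx3.trans_eq ?_) hθ0
      ring
  have hvol := volume_le_qdist1 _ (scaleCB_nonempty (θ := θ) (hα n hn).1) (θ * u) hθ0 hcard
  set A := Ioc (θ * u) (θ * u + θ) ∩
    {x | θ / (4 * ((m : ℝ) + 2)) ≤ qdist1 x (scaleCB θ (α n))} with hA
  set v := l * Real.exp (-(l * (θ * u + θ))) * (θ / (4 * ((m : ℝ) + 2))) ^ s with hv
  have hv0 : 0 ≤ v := by positivity
  have hη : θ / (4 * C) / n * Real.exp (p * u) ≤ θ / (4 * ((m : ℝ) + 2)) := by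
    rw [show θ / (4 * C) / n * Real.exp (p * u) = θ / (4 * (C * (n * Real.exp (-(p * u))))) by
      rw [Real.exp_neg]; field_simp]
    have := h n hn u hu
    gcongr
  have hη' := Real.rpow_le_rpow (by positivity) hη hs.le
  rw [Real.mul_rpow (by positivity) (by positivity), Real.div_rpow (by positivity) hn'.le,
    ← Real.exp_mul] at hη'
  have hexp : Real.exp (-(l * θ)) ≤ Real.exp (-(l * (θ * u + θ))) * Real.exp (p * u * s) := by
    rw [← Real.exp_add]
    refine Real.exp_le_exp.2 ?_
    have h1 : l * θ ≤ p * s := by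
      calc l * θ ≤ l * (s / (r + 1)) := mul_le_mul_of_nonneg_left hθ hl.le
        _ = p * s := by rw [hp]; ring
    have h2 := mul_le_mul_of_nonneg_right h1 hu0
    linarith
  calc ENNReal.ofReal (l * Real.exp (-(l * θ)) * (θ / (4 * C)) ^ s * (θ / 2) / n ^ s)
      ≤ ENNReal.ofReal (v * (θ / 2)) := by
        refine ENNReal.ofReal_le_ofReal ?_
        calc _ = l * Real.exp (-(l * θ)) * ((θ / (4 * C)) ^ s / n ^ s) * (θ / 2) := by ring
          _ ≤ l * (Real.exp (-(l * (θ * u + θ))) * Real.exp (p * u * s)) *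
              ((θ / (4 * C)) ^ s / n ^ s) * (θ / 2) := by gcongr
          _ = l * Real.exp (-(l * (θ * u + θ))) *
              ((θ / (4 * C)) ^ s / n ^ s * Real.exp (p * u * s)) * (θ / 2) := by ring
          _ ≤ _ := by rw [hv]; gcongr
    _ = ENNReal.ofReal v * ENNReal.ofReal (θ / 2) := ENNReal.ofReal_mul hv0
    _ ≤ ENNReal.ofReal v * volume A := by gcongr
    _ = ∫⁻ _ in A, ENNReal.ofReal v := (setLIntegral_const _ _).symm
    _ ≤ ∫⁻ x in A, ENNReal.ofReal
          (l * Real.exp (-(l * x)) * qdist1 x (scaleCB θ (α n)) ^ s) := by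
        refine setLIntegral_mono
          (Measurable.mul (by fun_prop) (measurable_qdist1_rpow _ s)).ennreal_ofReal
          fun x hx => ENNReal.ofReal_le_ofReal ?_
        have h1 : θ / (4 * ((m : ℝ) + 2)) ≤ qdist1 x (scaleCB θ (α n)) := hx.2
        have h2 : x ≤ θ * u + θ := hx.1.2
        rw [hv]
        gcongr
    _ ≤ _ := lintegral_mono_set inter_subset_left

lemma mul_le_lintegral_Ioi {f : ℝ → ℝ≥0∞} {θ : ℝ} (hθ : 0 < θ) {c : ℝ≥0∞} (K : ℕ)
    (h : ∀ k < K, c ≤ ∫⁻ x in Ioc (θ * k) (θ * k + θ), f x) :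
    K * c ≤ ∫⁻ x in Ioi 0, f x := by
  have key : ∀ j ≤ K, j * c ≤ ∫⁻ x in Ioc 0 (θ * j), f x := by
    intro j
    induction j with
    | zero => simp
    | succ j ih =>
      intro hj
      have h0 : 0 ≤ θ * j := by positivity
      rw [show θ * ((j + 1 : ℕ) : ℝ) = θ * j + θ by push_cast; ring,
        ← Ioc_union_Ioc_eq_Ioc h0 (by linarith : θ * j ≤ θ * j + θ),
        lintegral_union measurableSet_Ioc (Ioc_disjoint_Ioc_of_le le_rfl)]
      push_cast
      rw [add_mul, one_mul]
      exact add_le_add (ih (by omega)) (h j (by omega))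
  exact (key K le_rfl).trans (lintegral_mono_set Ioc_subset_Ioi_self)

lemma OptimalSeq1.not_rateOptimal1_scaleCB {l r s θ : ℝ} (hl : 0 < l) (hr : 0 < r) (hs : 0 < s)
    {α : ℕ → Finset ℝ} (hα : OptimalSeq1 (expLaw l) r α) (hθ0 : 0 < θ)
    (hθ : θ ≤ s / (r + 1)) :
    ¬ RateOptimal1 (expLaw l) s fun n => scaleCB θ (α n) := by
  obtain ⟨c, hc, h⟩ := hα.exists_le_lintegral_Ioc hl hr hs hθ0 hθ
  have hp0 : 0 < l / (r + 1) := by positivity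
  have key : ∀ K : ℕ, (K : ℝ≥0∞) * ENNReal.ofReal c ≤
      limsup (fun n : ℕ => (n : ℝ≥0∞) ^ s * qerr1 (expLaw l) s (scaleCB θ (α n))) atTop := by
    intro K
    refine le_limsup_of_frequently_le' (Eventually.frequently ?_)
    filter_upwards [eventually_ge_atTop 1,
      eventually_ge_atTop ⌈Real.exp (l / (r + 1) * K)⌉₊] with n hn hnK
    have hn' : (0 : ℝ) < n := by exact_mod_cast hn
    rw [qerr1_expLaw hl hs.le]
    have h1 := mul_le_lintegral_Ioi hθ0 K (c := ENNReal.ofReal (c / n ^ s)) fun k hk =>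
      h n hn k k.cast_nonneg (by
        rw [Real.exp_neg, ← div_eq_mul_inv, one_le_div (Real.exp_pos _)]
        refine le_trans (Real.exp_le_exp.2 (mul_le_mul_of_nonneg_left ?_ hp0.le))
          (Nat.ceil_le.1 hnK)
        exact_mod_cast hk.le)
    refine le_trans (le_of_eq ?_) (mul_le_mul_right h1 _)
    rw [natCast_rpow_eq_ofReal n hs.le, mul_left_comm, ← ENNReal.ofReal_mul (by positivity),
      mul_div_cancel₀ _ (by positivity)]
  intro hrate
  obtain ⟨K, hK⟩ := ENNReal.exists_nat_mul_gt (ENNReal.ofReal_pos.2 hc).ne' hrate.ne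
  exact absurd (hK.trans_le (key K)) (lt_irrefl _)

lemma expF_eq {l r s θ : ℝ} (hl : 0 < l) (hr : 0 < r) (hs : 0 < s) (hθ : s / (r + 1) < θ) :
    expF l r s θ = ENNReal.ofReal
      (θ ^ (s + 1) / (θ - s / (r + 1)) * l ^ (-(s / (r + 1)))) := by
  have hθ0 : 0 < θ := lt_trans (by positivity) hθ
  set q := s / (r + 1) with hq
  have ha : 0 < l * (θ - q) := mul_pos hl (sub_pos.2 hθ)
  have hint : ∫⁻ x in Ioi (0 : ℝ), ENNReal.ofReal (expDensity l (θ * x)) *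
      ENNReal.ofReal (expDensity l x) ^ (-q) =
      ∫⁻ x in Ioi (0 : ℝ), ENNReal.ofReal (l * l ^ (-q)) *
        ENNReal.ofReal (Real.exp (-(l * (θ - q) * x))) := by
    refine setLIntegral_congr_fun measurableSet_Ioi fun x hx => ?_
    have hx : 0 < x := hx
    simp only [expDensity, if_pos hx, if_pos (mul_pos hθ0 hx)]
    rw [ENNReal.ofReal_rpow_of_pos (by positivity), ← ENNReal.ofReal_mul (by positivity),
      ← ENNReal.ofReal_mul (by positivity), Real.mul_rpow hl.le (by positivity), ← Real.exp_mul]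
    congr 1
    rw [show -(l * (θ - q) * x) = -(l * (θ * x)) + -(l * x) * -q by ring, Real.exp_add]
    ring
  unfold expF
  rw [hint, lintegral_const_mul _ (by fun_prop), lintegral_exp_Ioi ha,
    ENNReal.ofReal_rpow_of_pos hθ0, ← ENNReal.ofReal_mul (by positivity),
    ← ENNReal.ofReal_mul (by positivity)]
  congr 1
  have : θ - q ≠ 0 := (sub_pos.2 hθ).ne'
  field_simp

lemma rpow_div_sub_lt {r s θ : ℝ} (hr : 0 < r) (hs : 0 < s) (hθ : s / (r + 1) < θ)
    (hne : θ ≠ (s + 1) / (r + 1)) :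
    ((s + 1) / (r + 1)) ^ (s + 1) / ((s + 1) / (r + 1) - s / (r + 1)) <
      θ ^ (s + 1) / (θ - s / (r + 1)) := by
  have hθ0 : 0 < θ := lt_trans (by positivity) hθ
  set τ := (s + 1) / (r + 1) with hτ
  have hτ0 : 0 < τ := by positivity
  have h1 : τ - s / (r + 1) = 1 / (r + 1) := by rw [hτ]; ring
  have hb := one_add_mul_self_lt_rpow_one_add (s := θ / τ - 1) (p := s + 1)
    (by have : 0 < θ / τ := by positivity
        linarith)
    (by rw [sub_ne_zero, Ne, div_eq_one_iff_eq hτ0.ne']; exact hne) (by linarith)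
  rw [add_sub_cancel, Real.div_rpow hθ0.le hτ0.le, lt_div_iff₀ (by positivity)] at hb
  have h2 : 1 + (s + 1) * (θ / τ - 1) = (r + 1) * (θ - s / (r + 1)) := by
    rw [hτ]; field_simp; ring
  rw [h2] at hb
  rw [h1, lt_div_iff₀ (sub_pos.2 hθ), div_div_eq_mul_div, div_one]
  linarith

/-- **Proposition 5.4 (a), exponential distribution, `s > r`.**
Let `s ∈ (r, r+1) ∪ (r+1, ∞)`, `X ~ E(λ)`, `(α_n)` `L^r(P)`-optimal.  Then
(i) `(θ·α_n)` is `L^s(P)`-rate-optimal iff `θ ∈ (s/(r+1), ∞)`;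
(ii) `θ* = (s+1)/(r+1)` is the unique minimizer of
`θ ↦ θ^{s+1} ∫_0^∞ f(θx) f(x)^{-s/(r+1)} dx` on `(s/(r+1), ∞)`. -/
theorem stmt_15 (r s : ℝ) (hr : 0 < r) (hs : r < s) (hsne : s ≠ r + 1)
    (l : ℝ) (hl : 0 < l)
    (P : Measure ℝ)
    (hP : P = volume.withDensity fun x => ENNReal.ofReal (expDensity l x))
    (α : ℕ → Finset ℝ) (hα : OptimalSeq1 P r α) :
    (∀ θ : ℝ, 0 < θ →
      (RateOptimal1 P s (fun n => scaleCB θ (α n)) ↔ s / (r + 1) < θ)) ∧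
    (∀ θ : ℝ, s / (r + 1) < θ →
      expF l r s ((s + 1) / (r + 1)) ≤ expF l r s θ ∧
      (expF l r s θ = expF l r s ((s + 1) / (r + 1)) → θ = (s + 1) / (r + 1))) := by
  have hs0 : 0 < s := hr.trans hs
  have hP' : P = expLaw l := hP
  subst hP'
  refine ⟨fun θ hθ0 => ⟨fun h => ?_, fun h => hα.rateOptimal1_scaleCB hl hr hs0 h⟩,
    fun θ hθ => ?_⟩
  · by_contra hθ
    exact hα.not_rateOptimal1_scaleCB hl hr hs0 hθ0 (not_lt.1 hθ) h
  · have hτ : s / (r + 1) < (s + 1) / (r + 1) := by gcongr; linarith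
    rw [expF_eq hl hr hs0 hθ, expF_eq hl hr hs0 hτ]
    by_cases hne : θ = (s + 1) / (r + 1)
    · exact ⟨by rw [hne], fun _ => hne⟩
    · have hθ0 : 0 < θ := lt_trans (by positivity) hθ
      have hpos : 0 < θ - s / (r + 1) := sub_pos.2 hθ
      have hlt := (ENNReal.ofReal_lt_ofReal_iff (by positivity)).2 (mul_lt_mul_of_pos_right
        (rpow_div_sub_lt hr hs0 hθ hne) (by positivity : 0 < l ^ (-(s / (r + 1)))))
      exact ⟨hlt.le, fun h => absurd h hlt.ne'⟩
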